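/- arXiv:2301.00171 — 2 statements merged into one kernel-verified Lean document; each statement's English description precedes it below -/
import Mathlib

section
/- Let F_n be the free group of finite rank n and let φ be an endomorphism of F_n. Then the stable image φ^∞(F_n) = ⋂_{k ≥ 1} φ^k(F_n) is a finitely generated free group of rank at most n. -/
/-- The `k`-th iterate of an endomorphism. -/
def iterHom {G : Type*} [Group G] (φ : G →* G) : ℕ → (G →* G)
  | 0 => MonoidHom.id G
  | k + 1 => φ.comp (iterHom φ k)

/-- The stable image `φ^∞(G) = ⋂_{k ≥ 1} φ^k(G)` of an endomorphism `φ`. -/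
def stableImage {G : Type*} [Group G] (φ : G →* G) : Subgroup G :=
  ⨅ k : ℕ, (iterHom φ (k + 1)).range

namespace FreeGroup

theorem card_le_card_of_surjective {α β : Type*} [Fintype α] [Fintype β]
    (f : FreeGroup α →* FreeGroup β) (hf : Function.Surjective f) :
    Fintype.card β ≤ Fintype.card α := by
  classical
  let M := Multiplicative (ZMod 2)
  have h : Function.Injective fun c : β → M => lift.symm ((lift c).comp f) := by
    intro c d hcd
    exact lift.injective ((MonoidHom.cancel_right hf).1 (lift.symm.injective hcd))
  have hcard := Fintype.card_le_of_injective _ h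
  have hM : Fintype.card M = 2 := ZMod.card 2
  rw [Fintype.card_fun, Fintype.card_fun, hM] at hcard
  exact (Nat.pow_le_pow_iff_right one_lt_two).1 hcard

variable {α : Type*} [DecidableEq α]

/-- The subgroup generated by the elements of `K` of word length at most `L`. -/
def ballSubgroup (K : Subgroup (FreeGroup α)) (L : ℕ) : Subgroup (FreeGroup α) :=
  Subgroup.closure {g | g ∈ K ∧ g.norm ≤ L}

theorem ballSubgroup_le (K : Subgroup (FreeGroup α)) (L : ℕ) : ballSubgroup K L ≤ K :=
  (Subgroup.closure_le K).2 fun _ hg => hg.1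

theorem mem_ballSubgroup {K : Subgroup (FreeGroup α)} {L : ℕ} {g : FreeGroup α}
    (hg : g ∈ K) (hL : g.norm ≤ L) : g ∈ ballSubgroup K L :=
  Subgroup.subset_closure ⟨hg, hL⟩

/-- Every left coset has a representative of minimal word length. -/
theorem exists_geodesic_transversal (K : Subgroup (FreeGroup α)) :
    ∃ t : FreeGroup α ⧸ K → FreeGroup α, (∀ x, (t x : FreeGroup α ⧸ K) = x) ∧
      ∀ g : FreeGroup α, (t g).norm ≤ g.norm := by
  have h : ∀ x : FreeGroup α ⧸ K, ∃ t : FreeGroup α, (t : FreeGroup α ⧸ K) = x ∧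
      ∀ g : FreeGroup α, (g : FreeGroup α ⧸ K) = x → t.norm ≤ g.norm := by
    intro x
    obtain ⟨t, ht, hmin⟩ := (measure (norm (α := α))).wf.has_min
      {t : FreeGroup α | (t : FreeGroup α ⧸ K) = x} (QuotientGroup.mk_surjective x)
    exact ⟨t, ht, fun g hg => not_lt.1 (hmin g hg)⟩
  choose t ht hmin using h
  exact ⟨t, ht, fun g => hmin g g rfl⟩

/-- The subgroup generated by the short elements of `K` is a retract of `K`. -/
theorem exists_retraction_ballSubgroup (K : Subgroup (FreeGroup α)) (L : ℕ) :
    ∃ r : K →* ballSubgroup K L,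
      ∀ g (hg : g ∈ ballSubgroup K L), r ⟨g, ballSubgroup_le K L hg⟩ = ⟨g, hg⟩ := by
  classical
  obtain ⟨t, ht, hmin⟩ := exists_geodesic_transversal K
  have ht_mem : ∀ (s : FreeGroup α) (x : FreeGroup α ⧸ K), (t x)⁻¹ * s * t (s⁻¹ • x) ∈ K := by
    intro s x
    rw [mul_assoc, ← QuotientGroup.eq, ht]
    conv_rhs => rw [← smul_eq_mul, ← MulAction.Quotient.smul_mk, ht, smul_inv_smul]
  have ht_norm : ∀ (g : FreeGroup α) (x : FreeGroup α ⧸ K),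
      (t (g • x)).norm ≤ g.norm + (t x).norm := by
    intro g x
    have h := hmin (g * t x)
    rw [← smul_eq_mul, ← MulAction.Quotient.smul_mk, ht] at h
    exact h.trans (norm_mul_le _ _)
  have ht_one : t ((1 : FreeGroup α) : FreeGroup α ⧸ K) = 1 := by
    have h := hmin 1
    rwa [norm_one, Nat.le_zero, norm_eq_zero] at h
  let p : FreeGroup α → ballSubgroup K L := fun g => if h : g ∈ ballSubgroup K L then ⟨g, h⟩ else 1
  have hp : ∀ g (h : g ∈ ballSubgroup K L), p g = ⟨g, h⟩ := fun g h => dif_pos h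
  have hp_inv : ∀ g, (p g)⁻¹ = p g⁻¹ := by
    intro g
    by_cases h : g ∈ ballSubgroup K L
    · rw [hp g h, hp g⁻¹ (inv_mem h)]; rfl
    · simp only [p, dif_neg h, inv_mem_iff, inv_one]
  let A : FreeGroup α →* MulAut (FreeGroup α ⧸ K → ballSubgroup K L) := mulAutArrow
  let C : FreeGroup α →* (FreeGroup α ⧸ K → ballSubgroup K L) ⋊[A] FreeGroup α :=
    lift fun a => ⟨fun x => p ((t x)⁻¹ * of a * t ((of a)⁻¹ • x)), of a⟩
  have hA : ∀ g f x, A g f x = f (g⁻¹ • x) := fun g f x => rfl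
  have hC_right : ∀ w, (C w).right = w := by
    have : SemidirectProduct.rightHom.comp C = MonoidHom.id _ := by
      ext a; simp [C]
    exact fun w => DFunLike.congr_fun this w
  have hC_mul : ∀ v w x, (C (v * w)).left x = (C v).left x * (C w).left (v⁻¹ • x) := by
    intro v w x
    rw [_root_.map_mul, SemidirectProduct.mul_left, hC_right, Pi.mul_apply, hA]
  have hC_of : ∀ a x, (C (of a)).left x = p ((t x)⁻¹ * of a * t ((of a)⁻¹ • x)) := by
    intro a x; simp [C]
  have hC_letter : ∀ a b x, (C (mk [(a, b)])).left x =
      p ((t x)⁻¹ * mk [(a, b)] * t ((mk [(a, b)])⁻¹ • x)) := by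
    intro a b x
    cases b
    · have h : mk [(a, false)] = (of a)⁻¹ := rfl
      rw [h, _root_.map_inv, SemidirectProduct.inv_left, hC_right, hA, Pi.inv_apply, hC_of, hp_inv]
      simp [mul_assoc]
    · exact hC_of a x
  have hC_short : ∀ (l : List (α × Bool)) (x : FreeGroup α ⧸ K),
      (t x).norm + l.length + (t ((mk l)⁻¹ • x)).norm ≤ L →
      ((C (mk l)).left x : FreeGroup α) = (t x)⁻¹ * mk l * t ((mk l)⁻¹ • x) := by
    intro l
    induction l with
    | nil => intro x _; simp [← one_eq_mk]
    | cons s l ih =>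
      obtain ⟨a, b⟩ := s
      intro x hx
      have hmk : mk ((a, b) :: l) = mk [(a, b)] * mk l := by simp
      have hs : norm (mk [(a, b)]) ≤ 1 := norm_mk_le
      have hl : norm (mk l) ≤ l.length := norm_mk_le
      rw [hmk] at hx ⊢
      rw [mul_inv_rev, mul_smul] at hx ⊢
      set s := mk [(a, b)]
      have h₁ : (t (s⁻¹ • x)).norm ≤ l.length + (t ((mk l)⁻¹ • s⁻¹ • x)).norm := by
        have := ht_norm (mk l) ((mk l)⁻¹ • s⁻¹ • x)
        rw [smul_inv_smul] at this
        omega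
      have h₂ : (t (s⁻¹ • x)).norm ≤ 1 + (t x).norm := by
        have := ht_norm s⁻¹ x
        rw [norm_inv_eq] at this
        omega
      have h₃ : ((t x)⁻¹ * s * t (s⁻¹ • x)).norm ≤ L := by
        have h := norm_mul_le ((t x)⁻¹ * s) (t (s⁻¹ • x))
        have h' := norm_mul_le (t x)⁻¹ s
        rw [norm_inv_eq] at h'
        rw [List.length_cons] at hx
        omega
      have h₄ := ih (s⁻¹ • x) (by rw [List.length_cons] at hx; omega)
      rw [hC_mul, hC_letter, hp _ (mem_ballSubgroup (ht_mem s x) h₃), Subgroup.coe_mul, h₄]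
      group
  have hK : ∀ w ∈ K, w⁻¹ • ((1 : FreeGroup α) : FreeGroup α ⧸ K) = (1 : FreeGroup α) := by
    intro w hw
    rw [MulAction.Quotient.smul_mk, QuotientGroup.eq]
    simpa using hw
  let r : K →* ballSubgroup K L :=
    { toFun := fun w => (C w).left (1 : FreeGroup α)
      map_one' := by simp
      map_mul' := fun v w => by rw [Subgroup.coe_mul, hC_mul, hK v v.2] }
  refine ⟨r, fun g hg => ?_⟩
  have hr : r.comp (Subgroup.inclusion (ballSubgroup_le K L)) = MonoidHom.id _ := by
    refine MonoidHom.eq_of_eqOn_dense Subgroup.closure_closure_coe_preimage fun g hg => ?_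
    obtain ⟨hgK, hgL⟩ : (g : FreeGroup α) ∈ K ∧ (g : FreeGroup α).norm ≤ L := hg
    refine Subtype.ext ?_
    have h := hC_short (g : FreeGroup α).toWord (1 : FreeGroup α)
    rw [mk_toWord, hK g hgK, ht_one, norm_one] at h
    simp only [inv_one, one_mul, mul_one, zero_add, add_zero] at h
    exact h hgL
  exact DFunLike.congr_fun hr ⟨g, hg⟩

theorem finite_setOf_norm_le [Finite α] (L : ℕ) : {g : FreeGroup α | g.norm ≤ L}.Finite :=
  ((List.finite_length_le (α × Bool) L).image mk).subset fun g hg => ⟨g.toWord, hg, mk_toWord⟩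

/-- The intersection of a descending chain of `n`-generated subgroups of a free group of finite
rank is free of rank at most `n`. -/
theorem exists_iInf_mulEquiv_of_antitone [Finite α] {n : ℕ}
    (f : ℕ → FreeGroup (Fin n) →* FreeGroup α)
    (hf : Antitone fun k => (f k).range) :
    ∃ m ≤ n, Nonempty (↥(⨅ k, (f k).range) ≃* FreeGroup (Fin m)) := by
  classical
  set S : Subgroup (FreeGroup α) := ⨅ k, (f k).range
  let X := IsFreeGroup.Generators S
  have hX : ¬ Nonempty (Fin (n + 1) ↪ X) := by
    rintro ⟨e⟩
    let b : Fin (n + 1) → S := fun i => IsFreeGroup.of (e i)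
    obtain ⟨L, hL⟩ : ∃ L, ∀ i, (b i : FreeGroup α).norm ≤ L :=
      ⟨_, fun i => Finset.le_sup (f := fun i => (b i : FreeGroup α).norm) (Finset.mem_univ i)⟩
    obtain ⟨k, hk⟩ : ∃ k, ∀ g ∈ (f k).range, g.norm ≤ L → g ∈ S := by
      have h : ∀ g : FreeGroup α, ∃ k, g ∈ (f k).range → g ∈ S := by
        intro g
        by_contra! h
        exact (h 0).2 (Subgroup.mem_iInf.2 fun k => (h k).1)
      choose k hk using h
      obtain ⟨N, hN⟩ := ((finite_setOf_norm_le (α := α) L).image k).bddAbove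
      exact ⟨N, fun g hg hgL => hk g (hf (hN ⟨g, hgL, rfl⟩) hg)⟩
    have hle : ballSubgroup (f k).range L ≤ S :=
      (Subgroup.closure_le S).2 fun g hg => hk g hg.1 hg.2
    obtain ⟨r, hr⟩ := exists_retraction_ballSubgroup (f k).range L
    let q : S →* FreeGroup (Fin (n + 1)) :=
      IsFreeGroup.lift (Function.extend e FreeGroup.of fun _ => 1)
    have hq : ∀ i, q (b i) = FreeGroup.of i := by
      intro i
      rw [IsFreeGroup.lift_of, e.injective.extend_apply]
    let F := q.comp ((Subgroup.inclusion hle).comp (r.comp (f k).rangeRestrict))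
    have hF : Function.Surjective F := by
      rw [← MonoidHom.range_eq_top, eq_top_iff, ← FreeGroup.closure_range_of,
        Subgroup.closure_le]
      rintro _ ⟨i, rfl⟩
      have hbk : (b i : FreeGroup α) ∈ (f k).range := Subgroup.mem_iInf.1 (b i).2 k
      obtain ⟨w, hw⟩ := (f k).rangeRestrict_surjective ⟨b i, hbk⟩
      refine ⟨w, ?_⟩
      rw [← hq i]
      simp only [F, MonoidHom.comp_apply, hw, hr _ (mem_ballSubgroup hbk (hL i))]
      rfl
    have := card_le_card_of_surjective F hF
    simp at this
  have hfin : Finite X := by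
    by_contra h
    rw [not_finite_iff_infinite] at h
    exact hX ⟨(Fin.valEmbedding).trans (Infinite.natEmbedding X)⟩
  refine ⟨Nat.card X, ?_, ⟨(IsFreeGroup.toFreeGroup S).trans
    (FreeGroup.freeGroupCongr (Finite.equivFin X))⟩⟩
  by_contra! h
  exact hX ⟨(Fin.castLEEmb h).trans (Finite.equivFin X).symm.toEmbedding⟩

end FreeGroup

theorem iterHom_succ_apply {G : Type*} [Group G] (φ : G →* G) (k : ℕ) (g : G) :
    iterHom φ (k + 1) g = iterHom φ k (φ g) := by
  induction k with
  | zero => rfl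
  | succ k ih => exact congrArg φ ih

theorem antitone_range_iterHom {G : Type*} [Group G] (φ : G →* G) :
    Antitone fun k => (iterHom φ k).range := by
  refine antitone_nat_of_succ_le fun k => ?_
  rintro _ ⟨g, rfl⟩
  exact ⟨φ g, (iterHom_succ_apply φ k g).symm⟩

/-- **Imrich–Turner.** For an endomorphism `φ` of the free group of rank `n`, the stable
image `φ^∞(F_n)` is a finitely generated free group of rank at most `n`. -/
theorem stableImage_free_of_rank_le_of_freeGroup (n : ℕ)
    (φ : FreeGroup (Fin n) →* FreeGroup (Fin n)) :
    ∃ m : ℕ, m ≤ n ∧ Nonempty (↥(stableImage φ) ≃* FreeGroup (Fin m)) :=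
  FreeGroup.exists_iInf_mulEquiv_of_antitone (fun k => iterHom φ (k + 1))
    ((antitone_range_iterHom φ).comp_monotone fun _ _ h => Nat.succ_le_succ h)
end

section
/- Let G be a finitely generated residually finite group and let φ be an endomorphism of G. Then φ maps the stable image φ^∞(G) = ⋂_{k ≥ 1} φ^k(G) into itself, and the restriction of φ to φ^∞(G) is injective. -/
/-- A group is residually finite if every nontrivial element avoids some finite-index
normal subgroup. -/
def IsResiduallyFinite (G : Type*) [Group G] : Prop :=
  ∀ g : G, g ≠ 1 → ∃ N : Subgroup G, N.Normal ∧ N.index ≠ 0 ∧ g ∉ N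

theorem iterHom_apply {G : Type*} [Group G] (φ : G →* G) (k : ℕ) (x : G) :
    iterHom φ k x = φ^[k] x := by
  induction k with
  | zero => rfl
  | succ k ih => rw [Function.iterate_succ_apply', ← ih]; rfl

/-- There are finitely many homomorphisms from a finitely generated group to a finite group. -/
theorem finite_monoidHom_of_fg (G Q : Type*) [Group G] [Group.FG G] [Group Q] [Finite Q] :
    Finite (G →* Q) := by
  obtain ⟨S, hS⟩ := Group.fg_def.mp ‹Group.FG G›
  refine Finite.of_injective (fun (f : G →* Q) (s : S) => f s) fun f g hfg => ?_
  exact MonoidHom.eq_of_eqOn_dense hS fun s hs => congrFun hfg ⟨s, hs⟩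

theorem map_mem_stableImage {G : Type*} [Group G] (φ : G →* G) {x : G}
    (hx : x ∈ stableImage φ) : φ x ∈ stableImage φ := by
  simp only [stableImage, Subgroup.mem_iInf, MonoidHom.mem_range] at hx ⊢
  rintro (_ | k)
  · exact ⟨x, rfl⟩
  · obtain ⟨y, hy⟩ := hx k
    exact ⟨y, congrArg φ hy⟩

theorem exists_iterate_eq_of_mem_stableImage {G : Type*} [Group G] {φ : G →* G} {x : G}
    (hx : x ∈ stableImage φ) (k : ℕ) : ∃ y, φ^[k] y = x := by
  cases k with
  | zero => exact ⟨x, rfl⟩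
  | succ k =>
    obtain ⟨y, hy⟩ := Subgroup.mem_iInf.mp hx k
    exact ⟨y, by rw [← iterHom_apply, hy]⟩

theorem eq_one_of_mem_stableImage_of_map_eq_one {G : Type*} [Group G] [Group.FG G]
    (hrf : IsResiduallyFinite G) (φ : G →* G) {x : G} (hx : x ∈ stableImage φ)
    (h : φ x = 1) : x = 1 := by
  by_contra hne
  obtain ⟨N, hN, hindex, hxN⟩ := hrf x hne
  have : N.FiniteIndex := ⟨hindex⟩
  have := finite_monoidHom_of_fg G (G ⧸ N)
  obtain ⟨i, j, hij, heq⟩ : ∃ i j, i < j ∧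
      (QuotientGroup.mk' N).comp (iterHom φ i) = (QuotientGroup.mk' N).comp (iterHom φ j) := by
    obtain ⟨i, j, hne, heq⟩ := Finite.exists_ne_map_eq_of_infinite
      fun k => (QuotientGroup.mk' N).comp (iterHom φ k)
    rcases hne.lt_or_gt with hlt | hlt
    · exact ⟨i, j, hlt, heq⟩
    · exact ⟨j, i, hlt, heq.symm⟩
  obtain ⟨y, hy⟩ := exists_iterate_eq_of_mem_stableImage hx i
  obtain ⟨d, rfl⟩ := Nat.exists_eq_add_of_lt hij
  have hj : φ^[i + d + 1] y = 1 := by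
    rw [show i + d + 1 = d + 1 + i by omega, Function.iterate_add_apply, hy,
      Function.iterate_succ_apply, h, iterate_map_one]
  have hmk := DFunLike.congr_fun heq y
  simp only [MonoidHom.comp_apply, iterHom_apply, hy, hj, map_one] at hmk
  exact hxN ((QuotientGroup.eq_one_iff x).mp hmk)

/-- For an endomorphism `φ` of a finitely generated residually finite group `G`, `φ` maps
the stable image `φ^∞(G)` into itself and its restriction to `φ^∞(G)` is injective. -/
theorem stableImage_restriction_injective_of_residuallyFinite (G : Type*) [Group G]
    [Group.FG G] (hrf : IsResiduallyFinite G) (φ : G →* G) :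
    (∀ x ∈ stableImage φ, φ x ∈ stableImage φ) ∧
    ∃ ψ : ↥(stableImage φ) →* ↥(stableImage φ),
      (∀ x : ↥(stableImage φ), (ψ x : G) = φ ↑x) ∧ Function.Injective ψ := by
  refine ⟨fun x => map_mem_stableImage φ,
    (φ.comp (stableImage φ).subtype).codRestrict (stableImage φ)
      fun x => map_mem_stableImage φ x.2, fun x => rfl, ?_⟩
  refine (injective_iff_map_eq_one _).mpr fun x hx => ?_
  exact Subtype.ext
    (eq_one_of_mem_stableImage_of_map_eq_one hrf φ x.2 (congrArg Subtype.val hx))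
end
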